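/- For all integers i, j ≥ 0, the cardinality of W_{i,j} equals the Baxter number Θ_{ij}. -/

import Mathlib

/-- The four-letter alphabet `A = {e, ē, b, b̄}`; `eb` stands for `ē` and `bb` for `b̄`. -/
inductive A : Type
  | e | eb | b | bb
  deriving DecidableEq

/-- `w` is a Dyck word with opening letter `o` and closing letter `c`. -/
def IsDyck (o c : A) (w : List A) : Prop :=
  w.count o = w.count c ∧ ∀ ℓ : ℕ, (w.take ℓ).count c ≤ (w.take ℓ).count o

/-- `w^1 = w|_{{e,b̄}}`. -/
def sub1 (w : List A) : List A := w.filter (fun x => x == A.e || x == A.bb)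

/-- `w^2 = w|_{{ē,b̄}}`. -/
def sub2 (w : List A) : List A := w.filter (fun x => x == A.eb || x == A.bb)

/-- `w^3 = w|_{{ē,b}}`. -/
def sub3 (w : List A) : List A := w.filter (fun x => x == A.eb || x == A.b)

/-- Conditions (1)–(5) on a word over `A` (positions are 0-indexed). -/
def Conds (w : List A) : Prop :=
  (w[0]? = some A.e ∧ w[1]? = some A.b) ∧
  IsDyck A.e A.eb (w.filter (fun x => x == A.e || x == A.eb)) ∧
  IsDyck A.b A.bb (w.filter (fun x => x == A.b || x == A.bb)) ∧
  (∀ p q : ℕ, p < q → w[p]? = some A.b → w[q]? = some A.bb →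
      ∃ k, p ≤ k ∧ k ≤ q ∧ w[k]? = some A.eb) ∧
  (∀ p q : ℕ, 0 < p → p < q → w[p]? = some A.e → w[q]? = some A.eb →
      ∃ k, p ≤ k ∧ k ≤ q ∧ w[k]? = some A.bb)

/-- The set `W_{i,j}`. -/
def Wset (i j : ℕ) : Set (List A) :=
  { w | w.count A.e = j + 1 ∧ w.count A.eb = j + 1 ∧
        w.count A.b = i + 1 ∧ w.count A.bb = i + 1 ∧ Conds w }

/-- The Baxter number `Θ_{ij}` as a rational number. -/
noncomputable def baxter (i j : ℕ) : ℚ :=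
  (2 * (Nat.factorial (i + j)) * (Nat.factorial (i + j + 1)) *
      (Nat.factorial (i + j + 2)) : ℚ) /
    ((Nat.factorial i) * (Nat.factorial (i + 1)) * (Nat.factorial (i + 2)) *
      (Nat.factorial j) * (Nat.factorial (j + 1)) * (Nat.factorial (j + 2)))


set_option linter.unusedSimpArgs false

/-! ### Path counts -/

/-- Number of lattice paths with `a` horizontal and `b` vertical steps. -/
def PP (a b : ℤ) : ℤ := if 0 ≤ a ∧ 0 ≤ b then ((a + b).toNat.choose a.toNat : ℤ) else 0

lemma PP_nat (a b : ℕ) : PP a b = ((a + b).choose a : ℤ) := by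
  have : ((a : ℤ) + b).toNat = a + b := by omega
  simp [PP, this]

lemma PP_neg_left (a b : ℤ) (h : a < 0) : PP a b = 0 := by
  unfold PP; rw [if_neg]; omega

lemma PP_neg_right (a b : ℤ) (h : b < 0) : PP a b = 0 := by
  unfold PP; rw [if_neg]; omega

lemma PP_zero_left (b : ℤ) (h : 0 ≤ b) : PP 0 b = 1 := by
  unfold PP; simp [h]

lemma PP_zero_right (a : ℤ) (h : 0 ≤ a) : PP a 0 = 1 := by
  unfold PP; simp [h]

lemma PP_pascal (a b : ℤ) (h : ¬ (a = 0 ∧ b = 0)) : PP a b = PP (a - 1) b + PP a (b - 1) := by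
  rcases lt_or_ge a 0 with ha | ha
  · rw [PP_neg_left _ _ ha, PP_neg_left _ _ ha, PP_neg_left _ _ (by omega)]; rfl
  rcases lt_or_ge b 0 with hb | hb
  · rw [PP_neg_right _ _ hb, PP_neg_right _ _ hb, PP_neg_right _ _ (by omega)]; rfl
  obtain ⟨m, rfl⟩ := Int.eq_ofNat_of_zero_le ha
  obtain ⟨n, rfl⟩ := Int.eq_ofNat_of_zero_le hb
  rcases m with _ | m
  · rw [PP_neg_left (((0 : ℕ) : ℤ) - 1) _ (by simp)]
    have : n ≠ 0 := by rintro rfl; simp at h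
    simp only [Nat.cast_zero]
    rw [PP_zero_left _ (by omega), PP_zero_left _ (by omega)]; rfl
  rcases n with _ | n
  · rw [PP_neg_right _ ((0 : ℕ) - 1 : ℤ) (by simp)]
    simp only [Nat.cast_zero]
    rw [PP_zero_right _ (by omega), PP_zero_right _ (by omega)]; rfl
  have h1 : ((m + 1 : ℕ) : ℤ) - 1 = (m : ℕ) := by push_cast; ring
  have h2 : ((n + 1 : ℕ) : ℤ) - 1 = (n : ℕ) := by push_cast; ring
  rw [h1, h2, PP_nat, PP_nat, PP_nat]
  have : m + 1 + (n + 1) = (m + (n + 1)) + 1 := by ring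
  rw [this, Nat.choose_succ_succ]
  have : m + (n + 1) = m + 1 + n := by ring
  rw [this]; push_cast; ring

def det3 (a1 a2 a3 b1 b2 b3 c1 c2 c3 : ℤ) : ℤ :=
  a1 * (b2 * c3 - b3 * c2) - b1 * (a2 * c3 - a3 * c2) + c1 * (a2 * b3 - a3 * b2)

/-- LGV determinant, starts (-1,1), (0,0), (1,-1). -/
def DD (x1 y1 x2 y2 x3 y3 : ℤ) : ℤ :=
  det3 (PP (x1 + 1) (y1 - 1)) (PP x1 y1) (PP (x1 - 1) (y1 + 1))
    (PP (x2 + 1) (y2 - 1)) (PP x2 y2) (PP (x2 - 1) (y2 + 1))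
    (PP (x3 + 1) (y3 - 1)) (PP x3 y3) (PP (x3 - 1) (y3 + 1))

def NotStart (x y : ℤ) : Prop := x + y ≠ 0 ∨ x < -1 ∨ 1 < x

lemma pas3 (x y : ℤ) (h : NotStart x y) :
    PP (x + 1) (y - 1) = PP (x - 1 + 1) (y - 1) + PP (x + 1) (y - 1 - 1) ∧
    PP x y = PP (x - 1) y + PP x (y - 1) ∧
    PP (x - 1) (y + 1) = PP (x - 1 - 1) (y + 1) + PP (x - 1) (y - 1 + 1) := by
  unfold NotStart at h
  refine ⟨?_, ?_, ?_⟩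
  · rw [PP_pascal _ _ (by omega)]; congr 2; ring
  · rw [PP_pascal _ _ (by omega)]
  · rw [PP_pascal _ _ (by omega)]; congr 2; ring

lemma DD_pas1 (x1 y1 x2 y2 x3 y3 : ℤ) (h : NotStart x1 y1) :
    DD x1 y1 x2 y2 x3 y3 = DD (x1 - 1) y1 x2 y2 x3 y3 + DD x1 (y1 - 1) x2 y2 x3 y3 := by
  obtain ⟨h1, h2, h3⟩ := pas3 x1 y1 h
  unfold DD det3
  rw [h1, h2, h3]; ring

lemma DD_pas2 (x1 y1 x2 y2 x3 y3 : ℤ) (h : NotStart x2 y2) :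
    DD x1 y1 x2 y2 x3 y3 = DD x1 y1 (x2 - 1) y2 x3 y3 + DD x1 y1 x2 (y2 - 1) x3 y3 := by
  obtain ⟨h1, h2, h3⟩ := pas3 x2 y2 h
  unfold DD det3
  rw [h1, h2, h3]; ring

lemma DD_pas3 (x1 y1 x2 y2 x3 y3 : ℤ) (h : NotStart x3 y3) :
    DD x1 y1 x2 y2 x3 y3 = DD x1 y1 x2 y2 (x3 - 1) y3 + DD x1 y1 x2 y2 x3 (y3 - 1) := by
  obtain ⟨h1, h2, h3⟩ := pas3 x3 y3 h
  unfold DD det3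
  rw [h1, h2, h3]; ring

lemma DD_eq12 (x y x3 y3 : ℤ) : DD x y x y x3 y3 = 0 := by
  unfold DD det3; ring

lemma DD_eq23 (x y x1 y1 : ℤ) : DD x1 y1 x y x y = 0 := by
  unfold DD det3; ring

lemma DD_low (x1 y1 x2 y2 x3 : ℤ) : DD x1 y1 x2 y2 x3 (-2) = 0 := by
  unfold DD det3
  rw [PP_neg_right (x3 + 1) _ (by norm_num), PP_neg_right x3 _ (by norm_num),
    PP_neg_right (x3 - 1) _ (by norm_num)]; ring

lemma DD_left (y1 x2 y2 x3 y3 : ℤ) : DD (-2) y1 x2 y2 x3 y3 = 0 := by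
  unfold DD det3
  rw [PP_neg_left (-2 + 1) _ (by norm_num), PP_neg_left (-2) _ (by norm_num),
    PP_neg_left (-2 - 1) _ (by norm_num)]; ring

lemma DD_baseE (q s : ℤ) (hq : 1 ≤ q) (hs : 0 ≤ s) : DD (-1) q 0 q 1 (s - 1) = 1 := by
  unfold DD det3
  rw [PP_neg_left (-1) _ (by norm_num), PP_neg_left (-1 - 1) _ (by norm_num),
    PP_neg_left (0 - 1) _ (by norm_num)]
  norm_num
  rw [PP_zero_left _ (by omega), PP_zero_left _ (by omega), PP_zero_left _ (by omega)]; ring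

lemma DD_baseB (p r : ℤ) (hp : 1 ≤ p) (hr : 0 ≤ r) : DD (r - 1) 1 p 0 p (-1) = 1 := by
  unfold DD det3
  rw [PP_neg_right _ (-1) (by norm_num), PP_neg_right _ (-1 - 1) (by norm_num),
    PP_neg_right _ (0 - 1) (by norm_num)]
  norm_num
  rw [PP_zero_right _ (by omega), PP_zero_right _ (by omega), PP_zero_right _ (by omega)]; ring

/-! ### Word predicates -/

def DyG (o c : A) (x : ℕ) (w : List A) : Prop :=
  ∀ ℓ : ℕ, ((w.filter (fun t => t == o || t == c)).take ℓ).count c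
    ≤ x + ((w.filter (fun t => t == o || t == c)).take ℓ).count o

def QQ (o c z : A) (w : List A) : Prop :=
  ∀ p q : ℕ, p < q → w[p]? = some o → w[q]? = some c → ∃ k, p ≤ k ∧ k ≤ q ∧ w[k]? = some z

def HH (c z : A) (w : List A) : Prop :=
  ∀ q : ℕ, w[q]? = some c → ∃ k, k ≤ q ∧ w[k]? = some z

lemma DyG_open (o c : A) (h : o ≠ c) (x : ℕ) (w : List A) :
    DyG o c x (o :: w) ↔ DyG o c (x + 1) w := by
  unfold DyG
  simp only [List.filter_cons, beq_self_eq_true, Bool.true_or, if_true]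
  constructor
  · intro H l
    have := H (l + 1)
    simp [List.take_succ_cons, List.count_cons, h] at this ⊢
    omega
  · intro H l
    rcases l with _ | l
    · simp
    have := H l
    simp [List.take_succ_cons, List.count_cons, h] at this ⊢
    omega

lemma DyG_close (o c : A) (h : o ≠ c) (x : ℕ) (w : List A) :
    DyG o c x (c :: w) ↔ ∃ x', x = x' + 1 ∧ DyG o c x' w := by
  unfold DyG
  simp only [List.filter_cons, beq_self_eq_true, Bool.or_true, if_true]
  constructor
  · intro H
    have h1 := H 1
    simp [List.take_succ_cons, List.count_cons, h.symm] at h1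
    refine ⟨x - 1, by omega, ?_⟩
    intro l
    have := H (l + 1)
    simp [List.take_succ_cons, List.count_cons, h.symm] at this ⊢
    omega
  · rintro ⟨x', rfl, H⟩ l
    rcases l with _ | l
    · simp
    have := H l
    simp [List.take_succ_cons, List.count_cons, h.symm] at this ⊢
    omega

lemma DyG_other (o c a : A) (h : a ≠ o) (h' : a ≠ c) (x : ℕ) (w : List A) :
    DyG o c x (a :: w) ↔ DyG o c x w := by
  unfold DyG
  simp [List.filter_cons, h, h']

lemma DyG_nil (o c : A) (x : ℕ) : DyG o c x [] := by
  intro l; simp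

lemma HH_cons (c z a : A) (hcz : c ≠ z) (w : List A) :
    HH c z (a :: w) ↔ a = z ∨ (a ≠ c ∧ HH c z w) := by
  unfold HH
  constructor
  · intro H
    by_cases ha : a = z
    · exact Or.inl ha
    right
    refine ⟨?_, ?_⟩
    · rintro rfl
      obtain ⟨k, hk, hk'⟩ := H 0 (by simp)
      obtain rfl : k = 0 := by omega
      simp at hk'; exact ha hk'
    · intro q hq
      obtain ⟨k, hk, hk'⟩ := H (q + 1) (by simpa using hq)
      rcases k with _ | k
      · simp at hk'; exact absurd hk' ha
      · exact ⟨k, by omega, by simpa using hk'⟩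
  · rintro (rfl | ⟨h1, h2⟩) q hq
    · exact ⟨0, by omega, by simp⟩
    · rcases q with _ | q
      · simp at hq; exact absurd hq h1
      · obtain ⟨k, hk, hk'⟩ := h2 q (by simpa using hq)
        exact ⟨k + 1, by omega, by simpa using hk'⟩

lemma QQ_cons (o c z a : A) (hoc : o ≠ c) (hoz : o ≠ z) (w : List A) :
    QQ o c z (a :: w) ↔ QQ o c z w ∧ (a = o → HH c z w) := by
  unfold QQ HH
  constructor
  · intro H
    refine ⟨?_, ?_⟩
    · intro p q hpq hp hq
      obtain ⟨k, h1, h2, h3⟩ := H (p + 1) (q + 1) (by omega) (by simpa using hp) (by simpa using hq)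
      rcases k with _ | k
      · omega
      · exact ⟨k, by omega, by omega, by simpa using h3⟩
    · rintro rfl q hq
      obtain ⟨k, h1, h2, h3⟩ := H 0 (q + 1) (by omega) (by simp) (by simpa using hq)
      rcases k with _ | k
      · simp at h3; exact absurd h3 hoz
      · exact ⟨k, by omega, by simpa using h3⟩
  · rintro ⟨H1, H2⟩ p q hpq hp hq
    rcases q with _ | q
    · omega
    rcases p with _ | p
    · simp at hp
      obtain ⟨k, h1, h2⟩ := H2 hp q (by simpa using hq)
      exact ⟨k + 1, by omega, by omega, by simpa using h2⟩
    · obtain ⟨k, h1, h2, h3⟩ := H1 p q (by omega) (by simpa using hp) (by simpa using hq)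
      exact ⟨k + 1, by omega, by omega, by simpa using h3⟩

lemma HH_or (c z : A) (hcz : c ≠ z) (w : List A) : HH c z w ∨ HH z c w := by
  induction w with
  | nil => left; intro q hq; simp at hq
  | cons a w ih =>
    rw [HH_cons _ _ _ hcz, HH_cons _ _ _ hcz.symm]
    by_cases h1 : a = z
    · simp [h1]
    by_cases h2 : a = c
    · simp [h2]
    simpa [h1, h2] using ih

lemma HH_both (c z : A) (hcz : c ≠ z) (w : List A) (h1 : HH c z w) (h2 : HH z c w) :
    w.count c = 0 := by
  induction w with
  | nil => rfl
  | cons a w ih =>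
    rw [HH_cons _ _ _ hcz] at h1
    rw [HH_cons _ _ _ hcz.symm] at h2
    rcases h1 with rfl | ⟨ha, h1⟩
    · rcases h2 with h | ⟨h, _⟩
      · exact absurd h.symm hcz
      · exact absurd rfl h
    · rcases h2 with rfl | ⟨_, h2⟩
      · exact absurd rfl ha
      · simp [List.count_cons, ha, ih h1 h2]

/-- Suffixes of admissible words; `x`, `y` heights, `r`, `s` numbers of remaining `e`, `b`. -/
def Sem (fe fb : Bool) (x y r s : ℕ) : Set (List A) :=
  { w | w.count A.e = r ∧ w.count A.eb = x + r ∧ w.count A.b = s ∧ w.count A.bb = y + s ∧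
    DyG A.e A.eb x w ∧ DyG A.b A.bb y w ∧ QQ A.b A.bb A.eb w ∧ QQ A.e A.eb A.bb w ∧
    (fe = true → HH A.eb A.bb w) ∧ (fb = true → HH A.bb A.eb w) }

lemma Sem_e (fe fb : Bool) (x y r s : ℕ) (w : List A) :
    A.e :: w ∈ Sem fe fb x y r s ↔ ∃ r', r = r' + 1 ∧ w ∈ Sem true fb (x + 1) y r' s := by
  simp only [Sem, Set.mem_ofPred_eq, DyG_open A.e A.eb (by decide),
    DyG_other A.b A.bb A.e (by decide) (by decide),
    QQ_cons A.b A.bb A.eb A.e (by decide) (by decide),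
    QQ_cons A.e A.eb A.bb A.e (by decide) (by decide),
    HH_cons A.eb A.bb A.e (by decide), HH_cons A.bb A.eb A.e (by decide), List.count_cons]
  simp
  constructor
  · rintro ⟨h1, h2, h3, h4, h5, h6, h7, ⟨h8, h8'⟩, h9, h10⟩
    exact ⟨by omega, by omega, h3, h4, h5, h6, h7, h8, h8', h10⟩
  · rintro ⟨h1, h2, h3, h4, h5, h6, h7, h8, h9, h10⟩
    exact ⟨by omega, by omega, h3, h4, h5, h6, h7, ⟨h8, h9⟩, fun _ => h9, h10⟩

lemma Sem_b (fe fb : Bool) (x y r s : ℕ) (w : List A) :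
    A.b :: w ∈ Sem fe fb x y r s ↔ ∃ s', s = s' + 1 ∧ w ∈ Sem fe true x (y + 1) r s' := by
  simp only [Sem, Set.mem_ofPred_eq, DyG_open A.b A.bb (by decide),
    DyG_other A.e A.eb A.b (by decide) (by decide),
    QQ_cons A.b A.bb A.eb A.b (by decide) (by decide),
    QQ_cons A.e A.eb A.bb A.b (by decide) (by decide),
    HH_cons A.eb A.bb A.b (by decide), HH_cons A.bb A.eb A.b (by decide), List.count_cons]
  simp
  constructor
  · rintro ⟨h1, h2, h3, h4, h5, h6, ⟨h7, h7'⟩, h8, h9, h10⟩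
    exact ⟨by omega, by omega, by omega, by omega, h5, h6, h7, h8, h9, h7'⟩
  · rintro ⟨h1, h2, h3, h4, h5, h6, h7, h8, h9, h10⟩
    exact ⟨by omega, by omega, by omega, by omega, h5, h6, ⟨h7, h10⟩, h8, h9, fun _ => h10⟩

lemma Sem_eb (fb : Bool) (x y r s : ℕ) (w : List A) :
    A.eb :: w ∈ Sem false fb x y r s ↔ ∃ x', x = x' + 1 ∧ w ∈ Sem false false x' y r s := by
  simp only [Sem, Set.mem_ofPred_eq, DyG_close A.e A.eb (by decide),
    DyG_other A.b A.bb A.eb (by decide) (by decide),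
    QQ_cons A.b A.bb A.eb A.eb (by decide) (by decide),
    QQ_cons A.e A.eb A.bb A.eb (by decide) (by decide),
    HH_cons A.eb A.bb A.eb (by decide), HH_cons A.bb A.eb A.eb (by decide), List.count_cons]
  simp
  constructor
  · rintro ⟨h1, h2, h3, h4, ⟨x', rfl, h5⟩, h6, h7, h8⟩
    exact ⟨x', rfl, h1, by omega, h3, h4, h5, h6, h7, h8⟩
  · rintro ⟨x', rfl, h1, h2, h3, h4, h5, h6, h7, h8⟩
    exact ⟨h1, by omega, h3, h4, ⟨x', rfl, h5⟩, h6, h7, h8⟩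

lemma Sem_bb (fe : Bool) (x y r s : ℕ) (w : List A) :
    A.bb :: w ∈ Sem fe false x y r s ↔ ∃ y', y = y' + 1 ∧ w ∈ Sem false false x y' r s := by
  simp only [Sem, Set.mem_ofPred_eq, DyG_close A.b A.bb (by decide),
    DyG_other A.e A.eb A.bb (by decide) (by decide),
    QQ_cons A.b A.bb A.eb A.bb (by decide) (by decide),
    QQ_cons A.e A.eb A.bb A.bb (by decide) (by decide),
    HH_cons A.eb A.bb A.bb (by decide), HH_cons A.bb A.eb A.bb (by decide), List.count_cons]
  simp
  constructor
  · rintro ⟨h1, h2, h3, h4, h5, ⟨x', rfl, h6⟩, h7, h8⟩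
    exact ⟨x', rfl, h1, h2, h3, by omega, h5, h6, h7, h8⟩
  · rintro ⟨x', rfl, h1, h2, h3, h4, h5, h6, h7, h8⟩
    exact ⟨h1, h2, h3, by omega, h5, ⟨x', rfl, h6⟩, h7, h8⟩

lemma Sem_eb_t (fb : Bool) (x y r s : ℕ) (w : List A) : A.eb :: w ∉ Sem true fb x y r s := by
  simp [Sem, HH_cons A.eb A.bb A.eb (by decide)]

lemma Sem_bb_t (fe : Bool) (x y r s : ℕ) (w : List A) : A.bb :: w ∉ Sem fe true x y r s := by
  simp [Sem, HH_cons A.bb A.eb A.bb (by decide)]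

lemma Sem_tt (x y r s : ℕ) (w : List A) (h : w ∈ Sem true true x y r s) :
    x + r = 0 ∧ y + s = 0 := by
  obtain ⟨h1, h2, h3, h4, h5, h6, h7, h8, h9, h10⟩ := h
  have := HH_both _ _ (by decide) _ (h9 rfl) (h10 rfl)
  have := HH_both _ _ (by decide) _ (h10 rfl) (h9 rfl)
  omega

lemma Sem_nil (fe fb : Bool) (x y r s : ℕ) (h : [] ∈ Sem fe fb x y r s) :
    x + r = 0 ∧ y + s = 0 := by
  obtain ⟨h1, h2, h3, h4, h5⟩ := h
  simp at h1 h2 h3 h4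
  omega

/-! ### Counting -/

def HC (S : Set (List A)) (v : ℤ) : Prop := ∃ n : ℕ, S.encard = n ∧ (n : ℤ) = v

lemma HC_empty {S : Set (List A)} (h : ∀ w, w ∉ S) : HC S 0 := by
  refine ⟨0, ?_, rfl⟩
  simp [Set.eq_empty_iff_forall_notMem.mpr h]

lemma HC_union {S T U : Set (List A)} {a b : ℤ} (hS : HC S a) (hT : HC T b)
    (hd : ∀ w, w ∈ S → w ∈ T → False) (hU : ∀ w, w ∈ U ↔ w ∈ S ∨ w ∈ T) : HC U (a + b) := by
  obtain ⟨n, h1, rfl⟩ := hS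
  obtain ⟨m, h2, rfl⟩ := hT
  obtain rfl : U = S ∪ T := by ext w; exact hU w
  refine ⟨n + m, ?_, by push_cast; rfl⟩
  rw [Set.encard_union_eq (Set.disjoint_left.mpr fun w h h' => hd w h h'), h1, h2]
  push_cast; rfl

lemma HC_cons {S : Set (List A)} {v : ℤ} (c : A) (h : HC S v) : HC (List.cons c '' S) v := by
  obtain ⟨n, h1, rfl⟩ := h
  refine ⟨n, ?_, rfl⟩
  rw [(List.cons_injective).encard_image, h1]

lemma HC_two {U : Set (List A)} {a b : ℤ} (c d : A) (hcd : c ≠ d)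
    (h0 : ∀ w ∈ U, ∃ w', w = c :: w' ∨ w = d :: w')
    (h1 : HC {w | c :: w ∈ U} a) (h2 : HC {w | d :: w ∈ U} b) : HC U (a + b) := by
  refine HC_union (HC_cons c h1) (HC_cons d h2) ?_ ?_
  · rintro w ⟨u, _, rfl⟩ ⟨v, _, h⟩
    simp at h; exact hcd h.1.symm
  · intro w
    constructor
    · intro hw
      obtain ⟨w', rfl | rfl⟩ := h0 w hw
      · exact Or.inl ⟨w', hw, rfl⟩
      · exact Or.inr ⟨w', hw, rfl⟩
    · rintro (⟨u, hu, rfl⟩ | ⟨u, hu, rfl⟩) <;> exact hu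

lemma Sem_E_cases (x y r s : ℕ) (h : 1 ≤ x + r) (w : List A) (hw : w ∈ Sem false true x y r s) :
    ∃ w', w = A.eb :: w' ∨ w = A.b :: w' := by
  rcases w with _ | ⟨a, w⟩
  · have := Sem_nil _ _ _ _ _ _ hw; omega
  · rcases a
    · rw [Sem_e] at hw
      obtain ⟨r', rfl, hw⟩ := hw
      have := Sem_tt _ _ _ _ _ hw; omega
    · exact ⟨w, Or.inl rfl⟩
    · exact ⟨w, Or.inr rfl⟩
    · exact absurd hw (Sem_bb_t _ _ _ _ _ _)

lemma Sem_B_cases (x y r s : ℕ) (h : 1 ≤ y + s) (w : List A) (hw : w ∈ Sem true false x y r s) :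
    ∃ w', w = A.bb :: w' ∨ w = A.e :: w' := by
  rcases w with _ | ⟨a, w⟩
  · have := Sem_nil _ _ _ _ _ _ hw; omega
  · rcases a
    · exact ⟨w, Or.inr rfl⟩
    · exact absurd hw (Sem_eb_t _ _ _ _ _ _)
    · rw [Sem_b] at hw
      obtain ⟨r', rfl, hw⟩ := hw
      have := Sem_tt _ _ _ _ _ hw; omega
    · exact ⟨w, Or.inl rfl⟩

lemma HC_step {P : ℕ → Set (List A)} {U : Set (List A)} {x : ℕ} {v : ℤ}
    (hU : ∀ w, w ∈ U ↔ ∃ x', x = x' + 1 ∧ w ∈ P x')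
    (h0 : x = 0 → v = 0) (h1 : ∀ x', x = x' + 1 → HC (P x') v) : HC U v := by
  rcases x with _ | x
  · rw [h0 rfl]
    apply HC_empty
    intro w hw
    obtain ⟨x', h, _⟩ := (hU w).1 hw
    omega
  · have : U = P x := by
      ext w
      rw [hU]
      constructor
      · rintro ⟨x', h, hw⟩
        obtain rfl : x = x' := by omega
        exact hw
      · intro hw; exact ⟨x, rfl, hw⟩
    rw [this]; exact h1 x rfl

/-- base: no `eb` left -/
lemma HC_p0 (y s : ℕ) : HC (Sem false false 0 y 0 s) (if s = 0 then 1 else 0) := by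
  rcases s with _ | s
  · simp only [if_true]
    induction y with
    | zero =>
      refine ⟨1, ?_, rfl⟩
      have : Sem false false 0 0 0 0 = {[]} := by
        ext w
        rcases w with _ | ⟨a, w⟩
        · simp [Sem, DyG_nil, QQ]
        · rcases a <;> simp [Sem_e, Sem_b, Sem_eb, Sem_bb]
      rw [this]; simp
    | succ y ih =>
      have : Sem false false 0 (y + 1) 0 0 = List.cons A.bb '' Sem false false 0 y 0 0 := by
        ext w
        rcases w with _ | ⟨a, w⟩
        · simp [Sem]
        · rcases a <;> simp [Sem_e, Sem_b, Sem_eb, Sem_bb]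
      rw [this]; exact HC_cons _ ih
  · simp only [Nat.succ_ne_zero, if_false]
    apply HC_empty
    intro w
    induction w generalizing y with
    | nil => intro h; have := Sem_nil _ _ _ _ _ _ h; omega
    | cons a w ih =>
      rcases a
      · simp [Sem_e]
      · simp [Sem_eb]
      · rw [Sem_b]
        rintro ⟨s', hs, h⟩
        obtain ⟨h1, h2, h3, h4, h5, h6, h7, h8, h9, h10⟩ := h
        have h10 := h10 rfl
        have : 0 < w.count A.bb := by omega
        rw [List.count_pos_iff] at this
        obtain ⟨q, hq⟩ := List.mem_iff_getElem?.1 this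
        obtain ⟨k, _, hk⟩ := h10 q hq
        have := List.count_pos_iff.2 (List.mem_of_getElem? hk)
        omega
      · rw [Sem_bb]
        rintro ⟨y', hy, h⟩
        exact ih _ h

lemma HC_q0 (x r : ℕ) : HC (Sem false false x 0 r 0) (if r = 0 then 1 else 0) := by
  rcases r with _ | r
  · simp only [if_true]
    induction x with
    | zero => simpa using HC_p0 0 0
    | succ y ih =>
      have : Sem false false (y + 1) 0 0 0 = List.cons A.eb '' Sem false false y 0 0 0 := by
        ext w
        rcases w with _ | ⟨a, w⟩
        · simp [Sem]
        · rcases a <;> simp [Sem_e, Sem_b, Sem_eb, Sem_bb]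
      rw [this]; exact HC_cons _ ih
  · simp only [Nat.succ_ne_zero, if_false]
    apply HC_empty
    intro w
    induction w generalizing x with
    | nil => intro h; have := Sem_nil _ _ _ _ _ _ h; omega
    | cons a w ih =>
      rcases a
      · rw [Sem_e]
        rintro ⟨s', hs, h⟩
        obtain ⟨h1, h2, h3, h4, h5, h6, h7, h8, h9, h10⟩ := h
        have h9 := h9 rfl
        have : 0 < w.count A.eb := by omega
        rw [List.count_pos_iff] at this
        obtain ⟨q, hq⟩ := List.mem_iff_getElem?.1 this
        obtain ⟨k, _, hk⟩ := h9 q hq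
        have := List.count_pos_iff.2 (List.mem_of_getElem? hk)
        omega
      · rw [Sem_eb]
        rintro ⟨y', hy, h⟩
        exact ih _ h
      · simp [Sem_b]
      · simp [Sem_bb]

def vF (p q r s : ℤ) : ℤ := DD (r - 1) q p q p (s - 1)
def vE (p q r s : ℤ) : ℤ := DD (r - 1) q (p - 1) q p (s - 1)
def vB (p q r s : ℤ) : ℤ := DD (r - 1) q p (q - 1) p (s - 1)

theorem main_count (n : ℕ) : ∀ x y r s : ℕ, x + y + 2 * r + 2 * s = n → 1 ≤ x + r → 1 ≤ y + s →
    HC (Sem false true x y r s) (vE (x + r) (y + s) r s) ∧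
    HC (Sem true false x y r s) (vB (x + r) (y + s) r s) ∧
    HC (Sem false false x y r s) (vF (x + r) (y + s) r s) := by
  induction n using Nat.strong_induction_on with
  | _ n IH =>
  intro x y r s hn hp hq
  have hE : HC (Sem false true x y r s) (vE (x + r) (y + s) r s) := by
    by_cases hp1 : x + r = 1
    · -- base
      have h : vE (x + r) (y + s) r s =
          (if x = 1 ∧ s = 0 then 1 else 0) + (if x = 1 ∧ s ≠ 0 then 1 else 0) := by
        have hp1' : (x : ℤ) + r = 1 := by exact_mod_cast hp1
        unfold vE
        rw [hp1']
        by_cases hx : x = 1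
        · have : r = 0 := by omega
          subst this hx
          have := DD_baseE (y + s) s (by omega) (by omega)
          norm_num at this ⊢
          rw [this]
          by_cases hs : s = 0 <;> simp [hs]
        · have : r = 1 := by omega
          subst this
          have := DD_eq12 0 (y + s) 1 (s - 1)
          simp [hx, this]
      rw [h]
      refine HC_two A.eb A.b (by decide) (Sem_E_cases x y r s hp) ?_ ?_
      · refine HC_step (fun w => Sem_eb true x y r s w) ?_ ?_
        · rintro rfl; simp
        · rintro x' rfl
          have h1 : x' = 0 := by omega
          have h2 : r = 0 := by omega
          subst h1 h2
          simpa using HC_p0 y s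
      · refine HC_step (fun w => Sem_b false true x y r s w) ?_ ?_
        · rintro rfl; simp
        · rintro s' rfl
          have := (IH _ (by omega) x (y + 1) r s' rfl (by omega) (by omega)).1
          convert this using 1
          have hp1' : (x : ℤ) + r = 1 := by exact_mod_cast hp1
          unfold vE
          rw [hp1']
          by_cases hx : x = 1
          · have : r = 0 := by omega
            subst this hx
            have := DD_baseE ((y + 1 : ℕ) + s') s' (by push_cast; omega) (by omega)
            norm_num at this ⊢
            rw [this]
          · have : r = 1 := by omega
            subst this
            have := DD_eq12 0 ((y + 1 : ℕ) + s') 1 (s' - 1)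
            push_cast at this
            simp [hx, this]
    · have h : vE (x + r) (y + s) r s =
          vF (x + r - 1) (y + s) r s + vE (x + r) (y + s) r (s - 1) := by
        unfold vE vF
        rw [DD_pas3]
        unfold NotStart; omega
      rw [h]
      refine HC_two A.eb A.b (by decide) (Sem_E_cases x y r s hp) ?_ ?_
      · refine HC_step (fun w => Sem_eb true x y r s w) ?_ ?_
        · rintro rfl
          have := DD_eq12 (r - 1) (y + s) (r - 1) (s - 1)
          simp [vF, this]
        · rintro x' rfl
          have := (IH _ (by omega) x' y r s rfl (by omega) (by omega)).2.2
          convert this using 2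
          push_cast; ring
      · refine HC_step (fun w => Sem_b false true x y r s w) ?_ ?_
        · rintro rfl
          unfold vE
          norm_num
          exact DD_low _ _ _ _ _
        · rintro s' rfl
          have := (IH _ (by omega) x (y + 1) r s' rfl (by omega) (by omega)).1
          convert this using 2
          · push_cast; ring
          · push_cast; ring
  have hB : HC (Sem true false x y r s) (vB (x + r) (y + s) r s) := by
    by_cases hq1 : y + s = 1
    · have h : vB (x + r) (y + s) r s =
          (if y = 1 ∧ r = 0 then 1 else 0) + (if y = 1 ∧ r ≠ 0 then 1 else 0) := by
        have hq1' : (y : ℤ) + s = 1 := by exact_mod_cast hq1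
        unfold vB
        rw [hq1']
        by_cases hx : y = 1
        · have : s = 0 := by omega
          subst this hx
          have := DD_baseB (x + r) r (by omega) (by omega)
          norm_num at this ⊢
          rw [this]
          by_cases hs : r = 0 <;> simp [hs]
        · have : s = 1 := by omega
          subst this
          have := DD_eq23 (x + r) 0 (r - 1) 1
          simp [hx, this]
      rw [h]
      refine HC_two A.bb A.e (by decide) (Sem_B_cases x y r s hq) ?_ ?_
      · refine HC_step (fun w => Sem_bb true x y r s w) ?_ ?_
        · rintro rfl; simp
        · rintro x' rfl
          have h1 : x' = 0 := by omega
          have h2 : s = 0 := by omega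
          subst h1 h2
          simpa using HC_q0 x r
      · refine HC_step (fun w => Sem_e true false x y r s w) ?_ ?_
        · rintro rfl; simp
        · rintro s' rfl
          have := (IH _ (by omega) (x + 1) y s' s rfl (by omega) (by omega)).2.1
          convert this using 1
          have hq1' : (y : ℤ) + s = 1 := by exact_mod_cast hq1
          unfold vB
          rw [hq1']
          by_cases hx : y = 1
          · have : s = 0 := by omega
            subst this hx
            have := DD_baseB ((x + 1 : ℕ) + s') s' (by push_cast; omega) (by omega)
            norm_num at this ⊢
            rw [this]
          · have : s = 1 := by omega
            subst this
            have := DD_eq23 ((x + 1 : ℕ) + s') 0 (s' - 1) 1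
            push_cast at this
            simp [hx, this]
    · have h : vB (x + r) (y + s) r s =
          vF (x + r) (y + s - 1) r s + vB (x + r) (y + s) (r - 1) s := by
        unfold vB vF
        rw [DD_pas1, add_comm]
        unfold NotStart; omega
      rw [h]
      refine HC_two A.bb A.e (by decide) (Sem_B_cases x y r s hq) ?_ ?_
      · refine HC_step (fun w => Sem_bb true x y r s w) ?_ ?_
        · rintro rfl
          have := DD_eq23 (x + r) (s - 1) (r - 1) (s - 1)
          simp [vF, this]
        · rintro x' rfl
          have := (IH _ (by omega) x x' r s rfl (by omega) (by omega)).2.2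
          convert this using 2
          push_cast; ring
      · refine HC_step (fun w => Sem_e true false x y r s w) ?_ ?_
        · rintro rfl
          unfold vB
          norm_num
          exact DD_left _ _ _ _ _
        · rintro s' rfl
          have := (IH _ (by omega) (x + 1) y s' s rfl (by omega) (by omega)).2.1
          convert this using 2
          · push_cast; ring
          · push_cast; ring
  refine ⟨hE, hB, ?_⟩
  have h : vF (x + r) (y + s) r s = vE (x + r) (y + s) r s + vB (x + r) (y + s) r s := by
    unfold vE vF vB
    rw [DD_pas2]
    unfold NotStart; omega
  rw [h]
  refine HC_union hE hB ?_ ?_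
  · rintro w ⟨h1, h2, h3, h4, h5, h6, h7, h8, h9, h10⟩ ⟨_, _, _, _, _, _, _, _, h9', h10'⟩
    have := Sem_tt x y r s w ⟨h1, h2, h3, h4, h5, h6, h7, h8, h9', h10⟩
    omega
  · intro w
    have := HH_or A.eb A.bb (by decide) w
    simp [Sem]
    tauto

/-! ### Linking -/

lemma Wset_eq (i j : ℕ) :
    Wset i j = List.cons A.e '' (List.cons A.b '' Sem false true 1 1 j i) := by
  ext w
  rw [Set.image_image]
  have key : ∀ u : List A, A.e :: A.b :: u ∈ Wset i j ↔ u ∈ Sem false true 1 1 j i := by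
    intro u
    have e1 : ∀ o c : A, o ≠ c → ∀ v : List A,
        IsDyck o c (v.filter (fun x => x == o || x == c)) ↔
        v.count o = v.count c ∧ DyG o c 0 v := by
      intro o c h v
      unfold IsDyck DyG
      simp [List.count_filter]
    have q5 : (∀ p q : ℕ, 0 < p → p < q → (A.e :: A.b :: u)[p]? = some A.e →
        (A.e :: A.b :: u)[q]? = some A.eb →
        ∃ k, p ≤ k ∧ k ≤ q ∧ (A.e :: A.b :: u)[k]? = some A.bb) ↔
        QQ A.e A.eb A.bb (A.b :: u) := by
      unfold QQ
      constructor
      · intro H p q hpq hp hq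
        obtain ⟨k, h1, h2, h3⟩ := H (p + 1) (q + 1) (by omega) (by omega) (by simpa using hp)
          (by simpa using hq)
        rcases k with _ | k
        · omega
        · exact ⟨k, by omega, by omega, by simpa using h3⟩
      · intro H p q h0 hpq hp hq
        rcases p with _ | p
        · omega
        rcases q with _ | q
        · omega
        obtain ⟨k, h1, h2, h3⟩ := H p q (by omega) (by simpa using hp) (by simpa using hq)
        exact ⟨k + 1, by omega, by omega, by simpa using h3⟩
    have q4 : (∀ p q : ℕ, p < q → (A.e :: A.b :: u)[p]? = some A.b →
        (A.e :: A.b :: u)[q]? = some A.bb →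
        ∃ k, p ≤ k ∧ k ≤ q ∧ (A.e :: A.b :: u)[k]? = some A.eb) ↔
        QQ A.b A.bb A.eb (A.e :: A.b :: u) := Iff.rfl
    unfold Wset Conds
    rw [Set.mem_ofPred_eq, q5, q4, e1 A.e A.eb (by decide), e1 A.b A.bb (by decide)]
    simp only [Sem, Set.mem_ofPred_eq, DyG_open A.b A.bb (by decide),
      DyG_open A.e A.eb (by decide),
      DyG_other A.e A.eb A.b (by decide) (by decide),
      DyG_other A.b A.bb A.e (by decide) (by decide),
      QQ_cons A.b A.bb A.eb A.b (by decide) (by decide),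
      QQ_cons A.b A.bb A.eb A.e (by decide) (by decide),
      QQ_cons A.e A.eb A.bb A.b (by decide) (by decide), List.count_cons]
    simp
    intro h1
    constructor
    · rintro ⟨h2, h3, h4, h5, h6, h7, h8⟩
      exact ⟨by omega, by omega, by omega, h5.2, h6.2, h7.1, h8, h7.2⟩
    · rintro ⟨h2, h3, h4, h5, h6, h7, h8, h9⟩
      exact ⟨by omega, by omega, by omega, ⟨by omega, h5⟩, ⟨by omega, h6⟩, ⟨h7, h9⟩, h8⟩
  constructor
  · intro hw
    have h := hw.2.2.2.2.1
    rcases w with _ | ⟨a, _ | ⟨c, u⟩⟩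
    · simp at h
    · simp at h
    · simp at h
      obtain ⟨rfl, rfl⟩ := h
      exact ⟨u, (key u).1 hw, rfl⟩
  · rintro ⟨u, hu, rfl⟩
    exact (key u).2 hu

/-! ### Closed form -/

lemma PP_fac (a b : ℕ) : (PP a b : ℚ) = (a + b).factorial / (a.factorial * b.factorial) := by
  rw [PP_nat, Int.cast_natCast, Nat.cast_add_choose]

lemma PP_sub1 (a b : ℕ) (c : ℤ) (hc : c = (a : ℤ) - 1) :
    (PP c (b + 1 : ℕ) : ℚ) = (a + b).factorial * a / (a.factorial * (b + 1).factorial) := by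
  subst hc
  rcases a with _ | a
  · rw [PP_neg_left _ _ (by norm_num)]; simp
  · have : ((a + 1 : ℕ) : ℤ) - 1 = (a : ℕ) := by push_cast; ring
    rw [this, PP_fac, show a + 1 + b = a + (b + 1) by ring, Nat.factorial_succ a]
    push_cast
    have := Nat.factorial_ne_zero a
    have := Nat.factorial_ne_zero (b + 1)
    field_simp

lemma PP_sub2 (a b : ℕ) (c : ℤ) (hc : c = (a : ℤ) - 2) :
    (PP c (b + 2 : ℕ) : ℚ) =
      (a + b).factorial * a * (a - 1) / (a.factorial * (b + 2).factorial) := by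
  subst hc
  rcases a with _ | _ | a
  · rw [PP_neg_left _ _ (by norm_num)]; simp
  · rw [PP_neg_left _ _ (by norm_num)]; simp
  · have : ((a + 1 + 1 : ℕ) : ℤ) - 2 = (a : ℕ) := by push_cast; ring
    rw [this, PP_fac, show a + 1 + 1 + b = a + (b + 2) by ring, Nat.factorial_succ (a + 1),
      Nat.factorial_succ a]
    push_cast
    have := Nat.factorial_ne_zero a
    have := Nat.factorial_ne_zero (b + 2)
    field_simp
    ring

lemma PP_symm (a b : ℤ) : PP a b = PP b a := by
  unfold PP
  by_cases h : 0 ≤ a ∧ 0 ≤ b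
  · rw [if_pos h, if_pos h.symm]
    obtain ⟨m, rfl⟩ := Int.eq_ofNat_of_zero_le h.1
    obtain ⟨n, rfl⟩ := Int.eq_ofNat_of_zero_le h.2
    have h1 : ((m : ℤ) + n).toNat = m + n := by omega
    have h2 : ((n : ℤ) + m).toNat = m + n := by omega
    rw [h1, h2]
    simp only [Int.toNat_natCast]
    rw [Nat.choose_symm_add]
  · rw [if_neg h, if_neg (fun h' => h h'.symm)]

lemma closed (i j : ℕ) : ((vE (j + 1) (i + 1) j i : ℤ) : ℚ) = baxter i j := by
  unfold vE DD det3
  have a1 : (PP (j - 1 + 1) (i + 1 - 1) : ℚ) = (j + i).factorial / (j.factorial * i.factorial) := by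
    rw [← PP_fac]; congr 2 <;> ring
  have a2 : (PP (j - 1) (i + 1) : ℚ) =
      (j + i).factorial * j / (j.factorial * (i + 1).factorial) := by
    rw [← PP_sub1 j i _ rfl]; norm_num
  have a3 : (PP (j - 1 - 1) (i + 1 + 1) : ℚ) =
      (j + i).factorial * j * (j - 1) / (j.factorial * (i + 2).factorial) := by
    rw [← PP_sub2 j i _ rfl]; congr 2
    ring
  have b1 : (PP (j + 1 - 1 + 1) (i + 1 - 1) : ℚ) =
      (j + 1 + i).factorial / ((j + 1).factorial * i.factorial) := by
    rw [← PP_fac]; congr 2 <;> push_cast <;> ring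
  have b2 : (PP (j + 1 - 1) (i + 1) : ℚ) =
      (j + (i + 1)).factorial / (j.factorial * (i + 1).factorial) := by
    rw [← PP_fac]; congr 2; ring
  have b3 : (PP (j + 1 - 1 - 1) (i + 1 + 1) : ℚ) =
      (j + (i + 1)).factorial * j / (j.factorial * (i + 1 + 1).factorial) := by
    rw [← PP_sub1 j (i + 1) _ rfl]; congr 2; ring
  have c1 : (PP (j + 1 + 1) (i - 1 - 1) : ℚ) =
      (i + j).factorial * i * (i - 1) / (i.factorial * (j + 2).factorial) := by
    rw [← PP_sub2 i j _ rfl, PP_symm]; congr 2; ring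
  have c2 : (PP (j + 1) (i - 1) : ℚ) =
      (i + j).factorial * i / (i.factorial * (j + 1).factorial) := by
    rw [← PP_sub1 i j _ rfl, PP_symm]; norm_num
  have c3 : (PP (j + 1 - 1) (i - 1 + 1) : ℚ) = (j + i).factorial / (j.factorial * i.factorial) := by
    rw [← PP_fac]; congr 2 <;> ring
  push_cast
  rw [a1, a2, a3, b1, b2, b3, c1, c2, c3]
  unfold baxter
  rw [show j + 1 + i = (i + j) + 1 by ring, show j + (i + 1) = (i + j) + 1 by ring,
    show j + i = i + j by ring]
  have hi := Nat.factorial_ne_zero i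
  have hj := Nat.factorial_ne_zero j
  simp only [Nat.factorial_succ, show i + 2 = i + 1 + 1 from rfl, show j + 2 = j + 1 + 1 from rfl,
    show i + j + 2 = i + j + 1 + 1 from rfl]
  push_cast
  have h1 : (i : ℚ) + 1 ≠ 0 := by positivity
  have h2 : (i : ℚ) + 1 + 1 ≠ 0 := by positivity
  have h3 : (j : ℚ) + 1 ≠ 0 := by positivity
  have h4 : (j : ℚ) + 1 + 1 ≠ 0 := by positivity
  field_simp
  ring

theorem card_Wset_eq_baxter (i j : ℕ) :
    ((Wset i j).ncard : ℚ) = baxter i j := by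
  have h := (main_count _ 1 1 j i rfl (by omega) (by omega)).1
  obtain ⟨n, h1, h2⟩ := HC_cons A.e (HC_cons A.b h)
  rw [← Wset_eq] at h1
  have : (Wset i j).ncard = n := by
    unfold Set.ncard; rw [h1]; rfl
  rw [this, ← closed]
  have h3 : ((n : ℤ) : ℚ) = ((vE (j + 1) (i + 1) j i : ℤ) : ℚ) := by
    rw [h2]; congr 2 <;> push_cast <;> ring
  exact_mod_cast h3
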